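/- Let D = Metric.ball (0 : ℂ) 1 be the open unit disk. Let f : ℂ → ℂ be continuously differentiable over ℝ on D (ContDiffOn ℝ 1 f D), mapping D into D, such that the restriction of f to D, viewed as a map D → D, is a proper map. Suppose the Jacobian determinant of f is positive at every point of D, i.e. det(fderiv ℝ f z) > 0 for all z ∈ D. Then f maps D bijectively onto D (Set.BijOn f D D). -/

import Mathlib

open Complex

/-- The Wirtinger derivative f_z at a point, defined from the real Fréchet derivative. -/
noncomputable def wirtingerZ (f : ℂ → ℂ) (z : ℂ) : ℂ :=
  ((fderiv ℝ f z) 1 - Complex.I * (fderiv ℝ f z) Complex.I) / 2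

/-- The conjugate Wirtinger derivative f_z̄ at a point. -/
noncomputable def wirtingerZBar (f : ℂ → ℂ) (z : ℂ) : ℂ :=
  ((fderiv ℝ f z) 1 + Complex.I * (fderiv ℝ f z) Complex.I) / 2

/-- The Beltrami coefficient μ_f = f_z̄ / f_z. -/
noncomputable def beltrami (f : ℂ → ℂ) (z : ℂ) : ℂ :=
  wirtingerZBar f z / wirtingerZ f z

theorem IsProperMap.isCoveringMap_of_isLocalHomeomorph {E X : Type*} [TopologicalSpace E]
    [TopologicalSpace X] [T2Space E] [T1Space X] {p : E → X} (hp : IsProperMap p)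
    (hloc : IsLocalHomeomorph p) : IsCoveringMap p := by
  refine isCoveringMap_iff_isCoveringMapOn_univ.2 fun x _ ↦ ?_
  have hφ : ∀ e ∈ p ⁻¹' {x}, ∃ φ : OpenPartialHomeomorph E X, e ∈ φ.source ∧ φ = p := by
    intro e _
    obtain ⟨φ, he, h⟩ := hloc e
    exact ⟨φ, he, h.symm⟩
  exact hp.isClosedMap.isEvenlyCovered_of_openPartialHomeomorph
    ((hp.isCompact_preimage isCompact_singleton).finite
      (.of_openPartialHomeomorph p subset_rfl hφ)) hφ

theorem IsCoveringMap.bijective_of_simplyConnectedSpace {E X : Type*} [TopologicalSpace E]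
    [TopologicalSpace X] [ConnectedSpace E] [SimplyConnectedSpace X] [LocallyPathConnectedSpace X]
    {p : E → X} (hp : IsCoveringMap p) : Function.Bijective p := by
  obtain ⟨e₀⟩ : Nonempty E := inferInstance
  obtain ⟨s, ⟨hs₀, hs⟩, -⟩ :=
    hp.existsUnique_continuousMap_lifts (ContinuousMap.id X) (p e₀) e₀ rfl
  have hright : Function.RightInverse s p := congrFun hs
  have hsp : s ∘ p = id := hp.eq_of_comp_eq (s.continuous.comp hp.continuous) continuous_id
    (funext fun e ↦ hright (p e)) e₀ hs₀
  exact ⟨Function.LeftInverse.injective (congrFun hsp), hright.surjective⟩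

theorem ContDiffOn.isLocalHomeomorphOn_of_det_ne_zero {E : Type*} [NormedAddCommGroup E]
    [NormedSpace ℝ E] [FiniteDimensional ℝ E] {f : E → E} {U : Set E} (hU : IsOpen U)
    (hf : ContDiffOn ℝ 1 f U)
    (hdet : ∀ x ∈ U, LinearMap.det (fderiv ℝ f x : E →ₗ[ℝ] E) ≠ 0) :
    IsLocalHomeomorphOn f U := by
  have : CompleteSpace E := FiniteDimensional.complete ℝ E
  intro x hx
  have hfx : ContDiffAt ℝ 1 f x := hf.contDiffAt (hU.mem_nhds hx)
  have hder : HasFDerivAt f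
      (((fderiv ℝ f x).toContinuousLinearEquivOfDetNeZero (hdet x hx) : E ≃L[ℝ] E) : E →L[ℝ] E)
      x := by
    rw [ContinuousLinearMap.coe_toContinuousLinearEquivOfDetNeZero]
    exact (hfx.differentiableAt one_ne_zero).hasFDerivAt
  exact ⟨hfx.toOpenPartialHomeomorph f hder one_ne_zero,
    hfx.mem_toOpenPartialHomeomorph_source hder one_ne_zero, rfl⟩

theorem IsLocalHomeomorphOn.isLocalHomeomorph_mapsTo_restrict {X Y : Type*} [TopologicalSpace X]
    [TopologicalSpace Y] {f : X → Y} {U : Set X} {V : Set Y} (hf : IsLocalHomeomorphOn f U)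
    (hU : IsOpen U) (hV : IsOpen V) (hmaps : Set.MapsTo f U V) :
    IsLocalHomeomorph (Set.MapsTo.restrict f U V hmaps) := by
  have hcomp : IsLocalHomeomorph (f ∘ ((↑) : U → X)) :=
    isLocalHomeomorph_iff_isLocalHomeomorphOn_univ.2 <|
      hf.comp (hU.isOpenEmbedding_subtypeVal.isLocalHomeomorph.isLocalHomeomorphOn)
        fun x _ ↦ x.2
  exact IsLocalHomeomorph.of_comp (f := Set.MapsTo.restrict f U V hmaps) hcomp
    hV.isOpenEmbedding_subtypeVal.isLocalHomeomorph (hf.continuousOn.mapsToRestrict hmaps)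

theorem pos_jacobian_selfmap_disk_bijective (f : ℂ → ℂ)
    (hreg : ContDiffOn ℝ 1 f (Metric.ball (0 : ℂ) 1))
    (hmaps : Set.MapsTo f (Metric.ball (0 : ℂ) 1) (Metric.ball (0 : ℂ) 1))
    (hproper : IsProperMap (Set.MapsTo.restrict f _ _ hmaps))
    (hjac : ∀ z ∈ Metric.ball (0 : ℂ) 1,
      0 < LinearMap.det ((fderiv ℝ f z) : ℂ →ₗ[ℝ] ℂ)) :
    Set.BijOn f (Metric.ball (0 : ℂ) 1) (Metric.ball (0 : ℂ) 1) := by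
  have hball : IsOpen (Metric.ball (0 : ℂ) 1) := Metric.isOpen_ball
  have hconv : Convex ℝ (Metric.ball (0 : ℂ) 1) := convex_ball 0 1
  have hne : (Metric.ball (0 : ℂ) 1).Nonempty := Metric.nonempty_ball.2 one_pos
  have : ContractibleSpace (Metric.ball (0 : ℂ) 1) := hconv.contractibleSpace hne
  have : LocallyPathConnectedSpace (Metric.ball (0 : ℂ) 1) := hball.locallyPathConnectedSpace
  have hloc := (hreg.isLocalHomeomorphOn_of_det_ne_zero hball
    fun z hz ↦ (hjac z hz).ne').isLocalHomeomorph_mapsTo_restrict hball hball hmaps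
  have hbij :=
    (hproper.isCoveringMap_of_isLocalHomeomorph hloc).bijective_of_simplyConnectedSpace
  exact ⟨hmaps, hmaps.restrict_inj.1 hbij.injective,
    (hmaps.restrict_surjective_iff).1 hbij.surjective⟩
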